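/- There is no 3×4 matrix σ, with entries taken from a set of 12 distinct integers, that is good on (i,j) for all i ∈ {1,2} and j ∈ {1,2,3}. -/

import Mathlib

/-- A real `m × n` matrix `A` is *supmodular* if for all indices `i < r` and `j < s`,
we have `A i j + A r s ≥ A i s + A r j`. -/
def Supmodular {m n : ℕ} (A : Matrix (Fin m) (Fin n) ℝ) : Prop :=
  ∀ (i r : Fin m) (j s : Fin n), i < r → j < s → A i j + A r s ≥ A i s + A r j

/-- An `m × n` matrix `σ` whose entries form a permutation of `1, 2, ..., m*n`. -/
def IsPermMatrix {m n : ℕ} (σ : Matrix (Fin m) (Fin n) ℕ) : Prop :=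
  Function.Injective (fun p : Fin m × Fin n => σ p.1 p.2) ∧
  ∀ p : Fin m × Fin n, 1 ≤ σ p.1 p.2 ∧ σ p.1 p.2 ≤ m * n

/-- `B` is a `σ`-arrangement of `A` if `B` is obtained from `A` by a bijection `π` of the
index set, and entries of `B` are ordered consistently with `σ`:
`σ p < σ q` implies `B p ≤ B q`. -/
def IsArrangement {m n : ℕ} (σ : Matrix (Fin m) (Fin n) ℕ)
    (A B : Matrix (Fin m) (Fin n) ℝ) : Prop :=
  ∃ π : (Fin m × Fin n) ≃ (Fin m × Fin n),
    (∀ p : Fin m × Fin n, B p.1 p.2 = A (π p).1 (π p).2) ∧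
    ∀ p q : Fin m × Fin n, σ p.1 p.2 < σ q.1 q.2 → B p.1 p.2 ≤ B q.1 q.2

/-- Among the four values `a = σ_{i,j}`, `b = σ_{i,j+1}`, `c = σ_{i+1,j}`, `d = σ_{i+1,j+1}`,
the maximum is `a` or `d`, and the minimum is `b` or `c`. -/
def Good4 {α : Type*} [LinearOrder α] (a b c d : α) : Prop :=
  (max (max a b) (max c d) = a ∨ max (max a b) (max c d) = d) ∧
  (min (min a b) (min c d) = b ∨ min (min a b) (min c d) = c)

/-- `σ` is good on `(i, j)` (with `i + 1 < m`, `j + 1 < n`, zero-based indices). -/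
def GoodOn {α : Type*} [LinearOrder α] {m n : ℕ} (σ : Matrix (Fin m) (Fin n) α)
    (i j : ℕ) (hi : i + 1 < m) (hj : j + 1 < n) : Prop :=
  Good4 (σ ⟨i, by omega⟩ ⟨j, by omega⟩) (σ ⟨i, by omega⟩ ⟨j + 1, hj⟩)
        (σ ⟨i + 1, hi⟩ ⟨j, by omega⟩) (σ ⟨i + 1, hi⟩ ⟨j + 1, hj⟩)

/-- `A` is *permutable* if its entries can be permuted so that the resulting matrix
is supmodular. -/
def Permutable {m n : ℕ} (A : Matrix (Fin m) (Fin n) ℝ) : Prop :=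
  ∃ π : (Fin m × Fin n) ≃ (Fin m × Fin n),
    Supmodular (Matrix.of fun i j => A (π (i, j)).1 (π (i, j)).2)

/-- The four possible shapes of a good square with distinct entries. -/
def Shape (a b c d : ℤ) : Prop :=
  (b < c ∧ b < d ∧ c < a ∧ d < a) ∨ (c < b ∧ c < d ∧ b < a ∧ d < a) ∨
  (b < c ∧ b < a ∧ c < d ∧ a < d) ∨ (c < b ∧ c < a ∧ b < d ∧ a < d)

lemma good4_shape {a b c d : ℤ} (h : Good4 a b c d) (hab : a ≠ b) (hac : a ≠ c)
    (had : a ≠ d) (hbc : b ≠ c) (hbd : b ≠ d) (hcd : c ≠ d) : Shape a b c d := by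
  unfold Good4 at h
  unfold Shape
  omega

/-- The purely order-theoretic core: entries are named row by row. -/
lemma core (a b c d e f g h p q r s : ℤ) :
    Shape b c f g → Shape f g q r → Shape a b e f → Shape e f p q →
    Shape c d g h → Shape g h r s → False := by
  rintro (k2 | k2 | k2 | k2) (k5 | k5 | k5 | k5) <;> (try (exfalso; omega)) <;>
    rintro (k1 | k1 | k1 | k1) <;> (try (exfalso; omega)) <;>
    rintro (k4 | k4 | k4 | k4) <;> (try (exfalso; omega)) <;>
    rintro (k3 | k3 | k3 | k3) <;> (try (exfalso; omega)) <;>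
    rintro (k6 | k6 | k6 | k6) <;> omega

/-- No 3×4 matrix with pairwise distinct integer entries is good on every (i,j). -/
theorem no_good_three_by_four (σ : Matrix (Fin 3) (Fin 4) ℤ)
    (hinj : Function.Injective (fun p : Fin 3 × Fin 4 => σ p.1 p.2)) :
    ¬ ∀ (i j : ℕ) (hi : i + 1 < 3) (hj : j + 1 < 4), GoodOn σ i j hi hj := by
  intro H
  have ne : ∀ (i k : Fin 3) (j l : Fin 4), (i, j) ≠ (k, l) → σ i j ≠ σ k l :=
    fun i k j l h e => h (hinj e)
  have sh : ∀ (i k : Fin 3) (j l : Fin 4), i ≠ k → j ≠ l →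
      Good4 (σ i j) (σ i l) (σ k j) (σ k l) → Shape (σ i j) (σ i l) (σ k j) (σ k l) := by
    intro i k j l hik hjl h
    refine good4_shape h ?_ ?_ ?_ ?_ ?_ ?_ <;> apply ne <;>
      simp [hik, hjl]
  exact core (σ 0 0) (σ 0 1) (σ 0 2) (σ 0 3) (σ 1 0) (σ 1 1) (σ 1 2) (σ 1 3)
    (σ 2 0) (σ 2 1) (σ 2 2) (σ 2 3)
    (sh 0 1 1 2 (by decide) (by decide) (H 0 1 (by omega) (by omega)))
    (sh 1 2 1 2 (by decide) (by decide) (H 1 1 (by omega) (by omega)))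
    (sh 0 1 0 1 (by decide) (by decide) (H 0 0 (by omega) (by omega)))
    (sh 1 2 0 1 (by decide) (by decide) (H 1 0 (by omega) (by omega)))
    (sh 0 1 2 3 (by decide) (by decide) (H 0 2 (by omega) (by omega)))
    (sh 1 2 2 3 (by decide) (by decide) (H 1 2 (by omega) (by omega)))
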